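/- Let C be the extended quaternary quadratic residue code of length 18. The shell C_13 is a combinatorial 3-(18, 13, 18018) design with repeated blocks: for every 3-element subset T of {1,…,18}, the number of codewords c ∈ C with wt(c) = 13 and T ⊆ supp(c) equals 18018. -/

import Mathlib

open scoped Classical

noncomputable section

/-- The field with four elements. -/
abbrev F4 := GaloisField 2 2

/-- Membership in the quaternary quadratic residue code of length 17: the codeword, viewed
as the polynomial `∑ cᵢ Xⁱ` modulo `X ^ 17 - 1`, lies in the ideal generated by the
polynomial whose roots are `α ^ ℓ` for `ℓ` running over the nonzero squares mod 17;
equivalently (as that generator is separable and divides `X ^ 17 - 1`), the codeword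
polynomial vanishes at `α ^ ℓ` for every nonzero square `ℓ` modulo 17. -/
def qr4Mem {K : Type} [Field K] [Algebra F4 K] (α : K) (c : Fin 17 → F4) : Prop :=
  ∀ ℓ : ZMod 17, ℓ ≠ 0 → IsSquare ℓ →
    ∑ i : Fin 17, algebraMap F4 K (c i) * α ^ (ℓ.val * (i : ℕ)) = 0

/-- Membership in the extended quaternary quadratic residue code of length 18: the first 17
coordinates form a codeword of the quadratic residue code of length 17 and the last
coordinate is minus the sum of the first 17. -/
def extQR4Mem {K : Type} [Field K] [Algebra F4 K] (α : K) (c : Fin 18 → F4) : Prop :=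
  qr4Mem α (fun i => c i.castSucc) ∧ c (Fin.last 17) = - ∑ i : Fin 17, c i.castSucc

/-- Hamming weight: the number of nonzero coordinates. -/
def wt {n : ℕ} {F : Type} [Zero F] (c : Fin n → F) : ℕ :=
  (Finset.univ.filter fun i => c i ≠ 0).card

/-- Support: the set of nonzero coordinate positions. -/
def supp {n : ℕ} {F : Type} [Zero F] (c : Fin n → F) : Finset (Fin n) :=
  Finset.univ.filter fun i => c i ≠ 0

/-- Parity of the number of `r < n` with `a r` for which the `r`-th bit of `j` is set. -/
def parity : ℕ → (ℕ → Bool) → ℕ → Bool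
  | 0, _, _ => false
  | n + 1, a, j => parity n a j ^^ (a n && j.testBit n)

/-- The truth table of `j ↦ parity n a j`, `j < 2 ^ n`, stored in the bits of a number. -/
def parityTable : ℕ → (ℕ → Bool) → ℕ
  | 0, _ => 0
  | n + 1, a => Nat.lor (parityTable n a)
      (Nat.shiftLeft (bif a n then Nat.xor (parityTable n a) (2 ^ 2 ^ n - 1) else parityTable n a)
        (2 ^ n))

/-- The number whose binary digits are the `j`-th bits of the members of a list (lowest first);
such a list of bit planes thus stores one number for every position `j`. -/
def planeValue : List ℕ → ℕ → ℕ
  | [], _ => 0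
  | p :: ps, j => (p.testBit j).toNat + 2 * planeValue ps j

/-- Add the bits of `c` to the numbers stored in a list of bit planes. -/
def addBits : List ℕ → ℕ → List ℕ
  | [], c => [c]
  | p :: ps, c => Nat.xor p c :: addBits ps (Nat.land p c)

/-- Add the numbers stored at positions `j` and `k + j`, for `j < k`, with carry plane `c`. -/
def foldPlanes (k : ℕ) : List ℕ → ℕ → List ℕ
  | [], c => [c]
  | p :: ps, c =>
    Nat.xor (Nat.xor (Nat.mod p (Nat.pow 2 k)) (Nat.shiftRight p k)) c ::
      foldPlanes k ps
        (Nat.lor (Nat.land (Nat.mod p (Nat.pow 2 k)) (Nat.shiftRight p k))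
          (Nat.land c (Nat.xor (Nat.mod p (Nat.pow 2 k)) (Nat.shiftRight p k))))

/-- The sum of the numbers stored at the positions `j < 2 ^ n`. -/
def planeTotal : ℕ → List ℕ → ℕ
  | 0, ps => planeValue ps 0
  | n + 1, ps => planeTotal n (foldPlanes (2 ^ n) ps 0)

/-- The truth table of the positions `j < m` at which the number `k` is stored. -/
def eqPlane (m : ℕ) : List ℕ → ℕ → ℕ
  | [], k => bif k.beq 0 then 2 ^ m - 1 else 0
  | p :: ps, k =>
    Nat.land (bif k.testBit 0 then p else Nat.xor p (2 ^ m - 1)) (eqPlane m ps (k / 2))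

/-- Check that every `k`-element sublist of a list of truth tables on `2 ^ n` positions has
exactly `N` common positions with `w`. -/
def checkSublists (n N : ℕ) : ℕ → ℕ → List ℕ → Bool
  | 0, w, _ => (planeTotal n [w]).beq N
  | _ + 1, _, [] => true
  | k + 1, w, x :: xs => checkSublists n N k (Nat.land w x) xs && checkSublists n N (k + 1) w xs

theorem parityTable_lt (n : ℕ) (a : ℕ → Bool) : parityTable n a < 2 ^ 2 ^ n := by
  induction n with
  | zero => simp [parityTable]
  | succ n ih =>
    have h2 : 2 ^ 2 ^ (n + 1) = 2 ^ (2 ^ n + 2 ^ n) := by congr 1; ring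
    have hs : ∀ x, x < 2 ^ 2 ^ n → x <<< 2 ^ n < 2 ^ 2 ^ (n + 1) := by
      intro x hx
      rw [Nat.shiftLeft_eq, h2, pow_add]
      gcongr
    refine Nat.or_lt_two_pow (ih.trans_le ?_) (hs _ ?_)
    · exact Nat.pow_le_pow_right two_pos (Nat.pow_le_pow_right two_pos n.le_succ)
    · cases a n
      · exact ih
      · exact Nat.xor_lt_two_pow ih (Nat.sub_lt (by positivity) one_pos)

theorem testBit_parityTable (n : ℕ) (a : ℕ → Bool) {j : ℕ} (hj : j < 2 ^ n) :
    (parityTable n a).testBit j = parity n a j := by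
  induction n generalizing j with
  | zero => simp [parityTable, parity]
  | succ n ih =>
    have par_add : ∀ (m i : ℕ), m ≤ n → parity m a (2 ^ n + i) = parity m a i := by
      intro m i hm
      induction m with
      | zero => rfl
      | succ m ihm =>
        rw [parity, parity, ihm (by omega), Nat.testBit_two_pow_add_gt (by omega)]
    change (parityTable n a ||| (bif a n then parityTable n a ^^^ (2 ^ 2 ^ n - 1)
      else parityTable n a) <<< 2 ^ n).testBit j = _
    rw [Nat.testBit_or, Nat.testBit_shiftLeft, parity]
    rcases lt_or_ge j (2 ^ n) with h | h
    · simp [ih h, Nat.not_le.2 h, Nat.testBit_lt_two_pow h]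
    · obtain ⟨i, rfl⟩ := Nat.exists_eq_add_of_le h
      have hi : i < 2 ^ n := by rw [pow_succ] at hj; omega
      have h0 : (parityTable n a).testBit (2 ^ n + i) = false :=
        Nat.testBit_lt_two_pow ((parityTable_lt n a).trans_le
          (Nat.pow_le_pow_right two_pos (Nat.le_add_right _ _)))
      rw [par_add n i le_rfl, h0, Nat.testBit_two_pow_add_eq, Nat.testBit_lt_two_pow hi]
      cases a n <;> simp [ih hi, hi, Nat.testBit_two_pow_sub_one]

theorem planeValue_addBits (ps : List ℕ) (c j : ℕ) :
    planeValue (addBits ps c) j = planeValue ps j + (c.testBit j).toNat := by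
  induction ps generalizing c with
  | nil => simp [addBits, planeValue]
  | cons p ps ih =>
    change ((p ^^^ c).testBit j).toNat + 2 * planeValue (addBits ps (p &&& c)) j = _
    rw [ih, Nat.testBit_xor, Nat.testBit_and, planeValue]
    cases p.testBit j <;> cases c.testBit j <;> simp <;> omega

theorem planeValue_foldl_addBits (l ps : List ℕ) (j : ℕ) :
    planeValue (l.foldl addBits ps) j =
      planeValue ps j + (l.map fun x => (x.testBit j).toNat).sum := by
  induction l generalizing ps with
  | nil => simp
  | cons x l ih => simp [ih, planeValue_addBits, add_assoc]

theorem planeValue_foldPlanes {k j : ℕ} (hj : j < k) (ps : List ℕ) (c : ℕ) :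
    planeValue (foldPlanes k ps c) j =
      planeValue ps j + planeValue ps (k + j) + (c.testBit j).toNat := by
  induction ps generalizing c with
  | nil => simp [foldPlanes, planeValue]
  | cons p ps ih =>
    change (((p % 2 ^ k) ^^^ (p >>> k) ^^^ c).testBit j).toNat + 2 * planeValue (foldPlanes k ps
      (((p % 2 ^ k) &&& (p >>> k)) ||| (c &&& ((p % 2 ^ k) ^^^ (p >>> k))))) j = _
    rw [ih]
    simp only [Nat.testBit_xor, Nat.testBit_and, Nat.testBit_or, planeValue,
      Nat.testBit_mod_two_pow, Nat.testBit_shiftRight, hj, decide_true, Bool.true_and]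
    cases p.testBit j <;> cases p.testBit (k + j) <;> cases c.testBit j <;> simp <;> omega

theorem planeTotal_eq (n : ℕ) (ps : List ℕ) :
    planeTotal n ps = ∑ j ∈ Finset.range (2 ^ n), planeValue ps j := by
  induction n generalizing ps with
  | zero => simp [planeTotal]
  | succ n ih =>
    rw [planeTotal, ih, pow_succ, mul_two, Finset.sum_range_add, ← Finset.sum_add_distrib]
    refine Finset.sum_congr rfl fun j hj => ?_
    simp [planeValue_foldPlanes (Finset.mem_range.1 hj)]

theorem testBit_eqPlane {m j : ℕ} (hj : j < m) (ps : List ℕ) (k : ℕ) :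
    (eqPlane m ps k).testBit j = decide (planeValue ps j = k) := by
  induction ps generalizing k with
  | nil =>
    cases k with
    | zero =>
      change (2 ^ m - 1).testBit j = _
      simp [planeValue, Nat.testBit_two_pow_sub_one, hj]
    | succ k =>
      change Nat.testBit 0 j = _
      simp [planeValue]
  | cons p ps ih =>
    change ((bif k.testBit 0 then p else p ^^^ (2 ^ m - 1)) &&& eqPlane m ps (k / 2)).testBit j = _
    rw [Nat.testBit_and, ih, planeValue, Nat.testBit_zero]
    rcases Nat.mod_two_eq_zero_or_one k with h | h <;> cases hp : p.testBit j <;>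
      simp [h, hp, Nat.testBit_two_pow_sub_one, hj] <;> omega

theorem checkSublists_spec {n N k w : ℕ} {l : List ℕ} (h : checkSublists n N k w l = true)
    {s : List ℕ} (hs : s.Sublist l) (hk : s.length = k) :
    ((Finset.range (2 ^ n)).filter
      fun j => w.testBit j = true ∧ ∀ x ∈ s, x.testBit j = true).card = N := by
  induction l generalizing k w s with
  | nil =>
    obtain rfl := List.sublist_nil.1 hs
    obtain rfl : k = 0 := by simpa using hk.symm
    have := Nat.eq_of_beq_eq_true h
    rw [planeTotal_eq] at this
    rw [← this, Finset.card_filter]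
    refine Finset.sum_congr rfl fun j _ => ?_
    cases hw : w.testBit j <;> simp [planeValue, hw]
  | cons x xs ih =>
    cases k with
    | zero =>
      obtain rfl := List.length_eq_zero_iff.1 hk
      have := Nat.eq_of_beq_eq_true h
      rw [planeTotal_eq] at this
      rw [← this, Finset.card_filter]
      refine Finset.sum_congr rfl fun j _ => ?_
      cases hw : w.testBit j <;> simp [planeValue, hw]
    | succ k =>
      rw [checkSublists, Bool.and_eq_true] at h
      cases hs with
      | cons _ hs => exact ih h.2 hs hk
      | cons_cons _ hs =>
        rw [← ih h.1 hs (by simpa using hk)]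
        congr 1
        ext j
        change _ ↔ j ∈ Finset.filter (fun j => (w &&& x).testBit j = true ∧ _) _
        simp [Nat.testBit_and, and_assoc]

/-- The entry in row `r` and column `i` of the generator matrix of the extended cyclic code of
length 18 whose generator polynomial has the binary digits of `g` as coefficients. -/
def genBit (g i r : ℕ) : Bool :=
  bif i.beq 17 then true else Nat.ble r i && g.testBit (i - r)

/-- The truth table of the `i`-th coordinate being nonzero, over pairs of binary messages of
length 9. -/
def coordTable (g i : ℕ) : ℕ :=
  Nat.lor (parityTable 18 fun r => Nat.blt r 9 && genBit g i r)
    (parityTable 18 fun r => Nat.ble 9 r && genBit g i (r - 9))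

/-- The truth table of the codeword having weight `w`. -/
def weightTable (w : ℕ) (l : List ℕ) : ℕ :=
  eqPlane (2 ^ 18) (l.foldl addBits []) w

/-- Check the `3`-design property of the shell of weight 13. -/
def checkDesign (g : ℕ) : Bool :=
  checkSublists 18 18018 3 (weightTable 13 ((List.range 18).map (coordTable g)))
    ((List.range 18).map (coordTable g))

/-- The element of `F4` with coordinates `a`, `b` with respect to `1`, `ω`. -/
def ofBits (ω : F4) (a b : Bool) : F4 :=
  (if a then 1 else 0) + if b then ω else 0

/-- The codeword with message `h`. -/
def encode (g : ℕ) (h : Fin 9 → F4) (i : Fin 18) : F4 :=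
  ∑ r : Fin 9, if genBit g i r then h r else 0

/-- The message over `F4` given by two binary messages, stored in the bits of `j`. -/
def message (ω : F4) (j : ℕ) (r : Fin 9) : F4 :=
  ofBits ω (j.testBit r) (j.testBit (9 + r))

theorem card_F4 : Nat.card F4 = 4 := GaloisField.card 2 2 two_ne_zero

instance : Finite F4 := Nat.finite_of_card_ne_zero (by rw [card_F4]; norm_num)

theorem exists_F4_ne : ∃ ω : F4, ω ≠ 0 ∧ ω ≠ 1 := by
  by_contra! h
  have hs : (Set.univ : Set F4) ⊆ {0, 1} := fun x _ => by
    by_cases hx : x = 0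
    · simp [hx]
    · simp [h x hx]
  have h1 := Set.ncard_le_ncard hs
  rw [Set.ncard_univ, card_F4] at h1
  rw [Set.ncard_pair zero_ne_one] at h1
  omega

theorem ofBits_eq_zero_iff {ω : F4} (h0 : ω ≠ 0) (h1 : ω ≠ 1) (a b : Bool) :
    ofBits ω a b = 0 ↔ a = false ∧ b = false := by
  cases a <;> cases b <;> simp [ofBits, h0]
  rw [CharTwo.add_eq_zero]
  exact h1.symm

theorem ofBits_inj {ω : F4} (h0 : ω ≠ 0) (h1 : ω ≠ 1) {a b a' b' : Bool}
    (h : ofBits ω a b = ofBits ω a' b') : a = a' ∧ b = b' := by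
  have key : ofBits ω (a ^^ a') (b ^^ b') = ofBits ω a b - ofBits ω a' b' := by
    rw [CharTwo.sub_eq_add]
    cases a <;> cases b <;> cases a' <;> cases b' <;>
      simp [ofBits, CharTwo.add_self_eq_zero, add_assoc, add_comm ω, CharTwo.add_cancel_left]
  rw [h, sub_self, ofBits_eq_zero_iff h0 h1] at key
  simpa using key

theorem sum_ite_testBit {e : F4} (n : ℕ) (a : ℕ → Bool) (j : ℕ) :
    (∑ r ∈ Finset.range n, if (a r && j.testBit r) = true then e else 0) =
      if parity n a j then e else 0 := by
  induction n with
  | zero => simp [parity]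
  | succ n ih =>
    rw [Finset.sum_range_succ, ih, parity]
    cases parity n a j <;> cases a n && j.testBit n <;> simp [CharTwo.add_self_eq_zero]

theorem encode_message (ω : F4) (g j : ℕ) (i : Fin 18) :
    encode g (message ω j) i =
      ofBits ω (parity 18 (fun r => Nat.blt r 9 && genBit g i r) j)
        (parity 18 (fun r => Nat.ble 9 r && genBit g i (r - 9)) j) := by
  have blt_eq : ∀ r, Nat.blt r 9 = decide (r < 9) := fun r => by
    rw [Bool.eq_iff_iff]; simp [Nat.blt_eq]
  have ble_eq : ∀ r, Nat.ble 9 r = decide (9 ≤ r) := fun r => by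
    rw [Bool.eq_iff_iff]; simp [Nat.ble_eq]
  rw [ofBits, ← sum_ite_testBit, ← sum_ite_testBit, encode]
  simp only [message]
  rw [Fin.sum_univ_eq_sum_range (fun r => if genBit g i r then
      ofBits ω (j.testBit r) (j.testBit (9 + r)) else 0) 9,
    Finset.sum_range_add _ 9 9, Finset.sum_range_add _ 9 9]
  rw [Finset.sum_eq_zero (s := Finset.range 9) (f := fun r =>
      if (Nat.ble 9 r && genBit g i (r - 9) && j.testBit r) = true then ω else 0),
    Finset.sum_eq_zero (s := Finset.range 9) (f := fun r =>
      if (Nat.blt (9 + r) 9 && genBit g i (9 + r) && j.testBit (9 + r)) = true then (1 : F4)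
      else 0), zero_add, add_zero, ← Finset.sum_add_distrib]
  · refine Finset.sum_congr rfl fun r hr => ?_
    have hr := Finset.mem_range.1 hr
    simp only [blt_eq, ble_eq, hr, ofBits, Nat.add_sub_cancel_left]
    cases genBit g i r <;> simp
  · intro r _
    simp [blt_eq]
  · intro r hr
    simp [ble_eq, Finset.mem_range.1 hr]

theorem message_injOn {ω : F4} (h0 : ω ≠ 0) (h1 : ω ≠ 1) :
    Set.InjOn (message ω) (Finset.range (2 ^ 18)) := by
  intro j hj j' hj' h
  simp only [Finset.coe_range, Set.mem_Iio] at hj hj'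
  have hb := fun r : Fin 9 => ofBits_inj h0 h1 (congrFun h r)
  refine Nat.eq_of_testBit_eq fun i => ?_
  rcases lt_or_ge i 9 with hi | hi
  · exact (hb ⟨i, hi⟩).1
  · obtain ⟨i, rfl⟩ := Nat.exists_eq_add_of_le hi
    rcases lt_or_ge i 9 with hi | hi
    · exact (hb ⟨i, hi⟩).2
    · have hle : 2 ^ 18 ≤ 2 ^ (9 + i) := Nat.pow_le_pow_right two_pos (by omega)
      rw [Nat.testBit_lt_two_pow (hj.trans_le hle), Nat.testBit_lt_two_pow (hj'.trans_le hle)]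

theorem message_surjOn {ω : F4} (h0 : ω ≠ 0) (h1 : ω ≠ 1) (h : Fin 9 → F4) :
    ∃ j < 2 ^ 18, message ω j = h := by
  have hc : (Set.univ : Set (Fin 9 → F4)).ncard ≤
      (message ω '' (Finset.range (2 ^ 18) : Set ℕ)).ncard := by
    rw [(message_injOn h0 h1).ncard_image, Set.ncard_coe_finset, Finset.card_range,
      Set.ncard_univ, Nat.card_fun, card_F4, Nat.card_fin]
    norm_num
  have he := Set.eq_of_subset_of_ncard_le (Set.subset_univ _) hc
  obtain ⟨j, hj, rfl⟩ := he.ge (Set.mem_univ h)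
  exact ⟨j, by simpa using hj, rfl⟩

theorem testBit_coordTable {ω : F4} (h0 : ω ≠ 0) (h1 : ω ≠ 1) (g : ℕ) (i : Fin 18) {j : ℕ}
    (hj : j < 2 ^ 18) :
    (coordTable g i).testBit j = decide (encode g (message ω j) i ≠ 0) := by
  change ((parityTable 18 fun r => Nat.blt r 9 && genBit g i r) |||
    (parityTable 18 fun r => Nat.ble 9 r && genBit g i (r - 9))).testBit j = _
  rw [Nat.testBit_or, testBit_parityTable _ _ hj, testBit_parityTable _ _ hj, encode_message,
    Bool.eq_iff_iff, decide_eq_true_iff, ne_eq, ofBits_eq_zero_iff h0 h1]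
  cases parity 18 (fun r => Nat.blt r 9 && genBit g i r) j <;> simp

theorem testBit_weightTable {ω : F4} (h0 : ω ≠ 0) (h1 : ω ≠ 1) (g w : ℕ) {j : ℕ}
    (hj : j < 2 ^ 18) :
    (weightTable w ((List.range 18).map (coordTable g))).testBit j =
      decide (wt (encode g (message ω j)) = w) := by
  have hsum : (((List.range 18).map (coordTable g)).map fun x => (x.testBit j).toNat).sum =
      wt (encode g (message ω j)) := by
    have hr : ∀ (n : ℕ) (f : ℕ → ℕ), ((List.range n).map f).sum = ∑ i ∈ Finset.range n, f i := by
      intro n f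
      induction n with
      | zero => simp
      | succ n ih => simp [List.range_succ, Finset.sum_range_succ, ih]
    rw [List.map_map, hr, wt, Finset.card_filter,
      ← Fin.sum_univ_eq_sum_range]
    refine Finset.sum_congr rfl fun i _ => ?_
    rw [Function.comp, testBit_coordTable h0 h1 g i hj]
    by_cases h : encode g (message ω j) i = 0 <;> simp [h]
  rw [weightTable, testBit_eqPlane hj, planeValue_foldl_addBits, hsum, planeValue, zero_add]

theorem card_messages {ω : F4} (h0 : ω ≠ 0) (h1 : ω ≠ 1) {g : ℕ} (hg : checkDesign g = true)
    {T : Finset (Fin 18)} (hT : T.card = 3) :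
    ((Finset.range (2 ^ 18)).filter fun j =>
      wt (encode g (message ω j)) = 13 ∧ T ⊆ supp (encode g (message ω j))).card = 18018 := by
  have hsub : (((List.finRange 18).filter (· ∈ T)).map fun i => coordTable g i.val).Sublist
      ((List.range 18).map (coordTable g)) := by
    rw [← List.map_coe_finRange_eq_range, List.map_map, Function.comp_def]
    exact List.Sublist.map _ List.filter_sublist
  have hlen : (((List.finRange 18).filter (· ∈ T)).map fun i => coordTable g i.val).length = 3 := by
    have : ((List.finRange 18).filter (· ∈ T)).toFinset = T := by
      ext i
      simp
    rw [List.length_map, ← List.toFinset_card_of_nodup ((List.nodup_finRange 18).filter _), this,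
      hT]
  rw [checkDesign] at hg
  refine Eq.trans (congrArg Finset.card ?_) (checkSublists_spec hg hsub hlen)
  refine Finset.filter_congr fun j hj => ?_
  have hj := Finset.mem_range.1 hj
  rw [testBit_weightTable h0 h1 g 13 hj, decide_eq_true_iff]
  refine and_congr_right fun _ => ?_
  simp only [List.mem_map, List.mem_filter, List.mem_finRange, true_and, decide_eq_true_eq,
    forall_exists_index, and_imp, forall_apply_eq_imp_iff₂, testBit_coordTable h0 h1 g _ hj,
    Finset.subset_iff, supp, Finset.mem_filter, Finset.mem_univ]

theorem checkDesign_313 : checkDesign 313 = true := by decide +kernel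

theorem checkDesign_471 : checkDesign 471 = true := by decide +kernel

open Polynomial in
/-- The polynomial of degree at most 8 with the binary digits of `g` as coefficients. -/
def genPoly (g : ℕ) : F4[X] :=
  ∑ k ∈ Finset.range 9, if g.testBit k then X ^ k else 0

open Polynomial in
/-- The polynomial with coefficients `h`. -/
def messagePoly (h : Fin 9 → F4) : F4[X] :=
  ∑ r : Fin 9, C (h r) * X ^ (r : ℕ)

section Cyclic

open Polynomial

theorem coeff_genPoly {g : ℕ} (hg : g < 2 ^ 9) (k : ℕ) :
    (genPoly g).coeff k = if g.testBit k then 1 else 0 := by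
  have : ∀ i, (if g.testBit i = true then (X : F4[X]) ^ i else 0).coeff k =
      if k = i then (if g.testBit i = true then 1 else 0) else 0 := by
    intro i
    split_ifs <;> simp_all [coeff_X_pow]
  rw [genPoly, finsetSum_coeff]
  simp only [this, Finset.sum_ite_eq, Finset.mem_range]
  by_cases hk : k < 9
  · simp [hk]
  · have : g.testBit k = false :=
      Nat.testBit_lt_two_pow (hg.trans_le (Nat.pow_le_pow_right two_pos (not_lt.1 hk)))
    simp [this]

theorem natDegree_genPoly {g : ℕ} (hg : g < 2 ^ 9) (h8 : g.testBit 8 = true) :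
    (genPoly g).natDegree = 8 := by
  refine natDegree_eq_of_le_of_coeff_ne_zero ?_ (by simp [coeff_genPoly hg, h8])
  refine natDegree_le_iff_coeff_eq_zero.2 fun k hk => ?_
  have : g.testBit k = false :=
    Nat.testBit_lt_two_pow (hg.trans_le (Nat.pow_le_pow_right two_pos hk))
  simp [coeff_genPoly hg, this]

theorem monic_genPoly {g : ℕ} (hg : g < 2 ^ 9) (h8 : g.testBit 8 = true) :
    (genPoly g).Monic := by
  rw [Monic, leadingCoeff, natDegree_genPoly hg h8, coeff_genPoly hg, if_pos h8]

theorem coeff_messagePoly (h : Fin 9 → F4) (r : Fin 9) : (messagePoly h).coeff r = h r := by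
  simp [messagePoly, coeff_X_pow, Fin.val_inj]

theorem natDegree_messagePoly (h : Fin 9 → F4) : (messagePoly h).natDegree ≤ 8 :=
  natDegree_sum_le_of_forall_le _ _ fun r _ =>
    (natDegree_C_mul_X_pow_le _ _).trans (by omega)

theorem messagePoly_coeff {q : F4[X]} (hq : q.natDegree ≤ 8) :
    messagePoly (fun r => q.coeff r) = q := by
  conv_rhs => rw [q.as_sum_range' 9 (by omega), ← Fin.sum_univ_eq_sum_range]
  simp [messagePoly, C_mul_X_pow_eq_monomial]

theorem coeff_genPoly_mul_messagePoly {g : ℕ} (hg : g < 2 ^ 9) (h : Fin 9 → F4) (i : Fin 17) :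
    (genPoly g * messagePoly h).coeff i = encode g h i.castSucc := by
  have ble_eq : ∀ a b, Nat.ble a b = decide (a ≤ b) := fun a b => by
    rw [Bool.eq_iff_iff]; simp [Nat.ble_eq]
  have hi : Nat.beq (i : ℕ) 17 = false := by
    rw [← Bool.not_eq_true, Nat.beq_eq]
    omega
  rw [messagePoly, Finset.mul_sum, finsetSum_coeff, encode]
  refine Finset.sum_congr rfl fun r _ => ?_
  rw [mul_left_comm, coeff_C_mul, coeff_mul_X_pow', coeff_genPoly hg, genBit, Fin.val_castSucc, hi,
    cond_false, ble_eq]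
  by_cases h1 : (r : ℕ) ≤ i <;> cases h2 : g.testBit (i - r) <;> simp [h1]

theorem natDegree_mul_messagePoly {g : ℕ} (hg : g < 2 ^ 9) (h8 : g.testBit 8 = true)
    (h : Fin 9 → F4) : (genPoly g * messagePoly h).natDegree < 17 := by
  have h1 := natDegree_mul_le (p := genPoly g) (q := messagePoly h)
  have h2 := natDegree_messagePoly h
  rw [natDegree_genPoly hg h8] at h1
  omega

theorem genPoly_mul_messagePoly {g : ℕ} (hg : g < 2 ^ 9) (h8 : g.testBit 8 = true)
    (h : Fin 9 → F4) :
    genPoly g * messagePoly h = ∑ i : Fin 17, C (encode g h i.castSucc) * X ^ (i : ℕ) := by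
  conv_lhs => rw [as_sum_range' _ 17 (natDegree_mul_messagePoly hg h8 h),
    ← Fin.sum_univ_eq_sum_range (fun i => monomial i ((genPoly g * messagePoly h).coeff i))]
  simp only [coeff_genPoly_mul_messagePoly hg, C_mul_X_pow_eq_monomial]

theorem encode_last (g : ℕ) (h : Fin 9 → F4) : encode g h (Fin.last 17) = ∑ r, h r := by
  simp [encode, genBit]

theorem encode_last_eq_neg_sum {g : ℕ} (hg : g < 2 ^ 9) (h8 : g.testBit 8 = true)
    (hodd : (genPoly g).eval 1 = 1) (h : Fin 9 → F4) :
    encode g h (Fin.last 17) = -∑ i : Fin 17, encode g h i.castSucc := by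
  have := congrArg (eval 1) (genPoly_mul_messagePoly hg h8 h)
  simp only [eval_mul, hodd, one_mul, messagePoly, eval_finsetSum, eval_C, eval_pow, eval_X,
    one_pow, mul_one] at this
  rw [encode_last, this, CharTwo.neg_eq]

theorem encode_injective {g : ℕ} (hg : g < 2 ^ 9) (h8 : g.testBit 8 = true) :
    Function.Injective (encode g) := by
  intro h h' e
  have := genPoly_mul_messagePoly hg h8 h
  rw [e, ← genPoly_mul_messagePoly hg h8 h'] at this
  have := mul_left_cancel₀ (monic_genPoly hg h8).ne_zero this
  ext r
  rw [← coeff_messagePoly h, this, coeff_messagePoly]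

theorem pow_mod_seventeen {K : Type} [Field K] {α : K} (hα : IsPrimitiveRoot α 17) (n : ℕ) :
    α ^ (n % 17) = α ^ n := by
  rw [hα.eq_orderOf, pow_mod_orderOf]

variable {K : Type} [Field K] [Algebra F4 K] {α : K}

theorem aeval_genPoly (g : ℕ) (β : K) :
    aeval β (genPoly g) = ∑ k ∈ Finset.range 9, if g.testBit k then β ^ k else 0 := by
  rw [genPoly, map_sum]
  refine Finset.sum_congr rfl fun k _ => ?_
  split_ifs <;> simp

theorem aeval_pow_two_pow {g : ℕ} (hα : aeval α (genPoly g) = 0) (t : ℕ) :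
    aeval (α ^ 2 ^ t) (genPoly g) = 0 := by
  have : CharP K 2 := charP_of_injective_algebraMap (algebraMap F4 K).injective 2
  induction t with
  | zero => simpa using hα
  | succ t ih =>
    rw [aeval_genPoly] at ih ⊢
    have h2 := congrArg (· ^ 2) ih
    simp only [CharTwo.sum_sq, ne_eq, OfNat.ofNat_ne_zero, not_false_eq_true, zero_pow] at h2
    refine (Finset.sum_congr rfl fun k _ => ?_).trans h2
    split_ifs
    · rw [pow_succ, pow_mul, pow_right_comm]
    · simp

theorem exists_square_val_eq (t : Fin 8) :
    ∃ ℓ : ZMod 17, ℓ ≠ 0 ∧ IsSquare ℓ ∧ ℓ.val = 2 ^ (t : ℕ) % 17 := by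
  refine ⟨(6 ^ (t : ℕ)) * (6 ^ (t : ℕ)), ?_, ⟨_, rfl⟩, ?_⟩ <;> revert t <;> decide

theorem square_val_eq {ℓ : ZMod 17} (h0 : ℓ ≠ 0) (hs : IsSquare ℓ) :
    ∃ t : Fin 8, ℓ.val = 2 ^ (t : ℕ) % 17 := by
  obtain ⟨y, rfl⟩ := hs
  revert y
  decide

theorem qr4Mem_iff_aeval (hα : IsPrimitiveRoot α 17) (c : Fin 17 → F4) :
    qr4Mem α c ↔
      ∀ t : Fin 8, aeval (α ^ 2 ^ (t : ℕ)) (∑ i : Fin 17, C (c i) * X ^ (i : ℕ)) = 0 := by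
  have hval : ∀ n, aeval (α ^ n) (∑ i : Fin 17, C (c i) * X ^ (i : ℕ)) =
      ∑ i : Fin 17, algebraMap F4 K (c i) * α ^ (n * (i : ℕ)) := fun n => by
    simp [pow_mul]
  constructor
  · intro h t
    obtain ⟨ℓ, h0, hs, hℓ⟩ := exists_square_val_eq t
    rw [← pow_mod_seventeen hα, ← hℓ, hval]
    exact h ℓ h0 hs
  · intro h ℓ h0 hs
    obtain ⟨t, ht⟩ := square_val_eq h0 hs
    rw [← hval, ht, pow_mod_seventeen hα]
    exact h t

theorem qr4Mem_iff {g : ℕ} (hg : g < 2 ^ 9) (h8 : g.testBit 8 = true)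
    (hα : IsPrimitiveRoot α 17) (hr : aeval α (genPoly g) = 0) (c : Fin 17 → F4) :
    qr4Mem α c ↔ ∃ h, c = fun i => encode g h i.castSucc := by
  rw [qr4Mem_iff_aeval hα]
  constructor
  · intro hc
    set P : F4[X] := ∑ i : Fin 17, C (c i) * X ^ (i : ℕ) with hP
    have hPc : ∀ i : Fin 17, P.coeff i = c i := fun i => by
      simp [hP, coeff_X_pow, Fin.val_inj]
    have hPd : P.natDegree ≤ 16 := natDegree_sum_le_of_forall_le _ _ fun i _ =>
      (natDegree_C_mul_X_pow_le _ _).trans (by omega)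
    have hm := monic_genPoly hg h8
    have hinj : Function.Injective fun t : Fin 8 => α ^ 2 ^ (t : ℕ) := by
      intro s t hst
      change α ^ 2 ^ (s : ℕ) = α ^ 2 ^ (t : ℕ) at hst
      rw [← pow_mod_seventeen hα, ← pow_mod_seventeen hα (2 ^ (t : ℕ))] at hst
      have hmod := hα.pow_inj (Nat.mod_lt _ (by norm_num)) (Nat.mod_lt _ (by norm_num)) hst
      clear hst
      revert s t
      decide
    have hrem : (P %ₘ genPoly g).map (algebraMap F4 K) = 0 := by
      refine eq_zero_of_natDegree_lt_card_of_eval_eq_zero _ hinj (fun t => ?_) ?_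
      · rw [eval_map_algebraMap, aeval_modByMonic_eq_self_of_root (aeval_pow_two_pow hr t)]
        exact hc t
      · rw [natDegree_map, Fintype.card_fin]
        have := natDegree_modByMonic_lt P hm (fun h1 => by
          have := natDegree_genPoly hg h8
          rw [h1, natDegree_one] at this
          omega)
        rwa [natDegree_genPoly hg h8] at this
    rw [Polynomial.map_eq_zero, modByMonic_eq_zero_iff_dvd hm] at hrem
    obtain ⟨q, hq⟩ := hrem
    have hqd : q.natDegree ≤ 8 := by
      by_cases hq0 : q = 0
      · simp [hq0]
      · rw [hq, natDegree_mul hm.ne_zero hq0, natDegree_genPoly hg h8] at hPd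
        omega
    refine ⟨fun r => q.coeff r, funext fun i => ?_⟩
    rw [← coeff_genPoly_mul_messagePoly hg, messagePoly_coeff hqd, ← hq, hPc]
  · rintro ⟨h, rfl⟩ t
    rw [← genPoly_mul_messagePoly hg h8, map_mul, aeval_pow_two_pow hr, zero_mul]

theorem extQR4Mem_iff {g : ℕ} (hg : g < 2 ^ 9) (h8 : g.testBit 8 = true)
    (hodd : (genPoly g).eval 1 = 1) (hα : IsPrimitiveRoot α 17)
    (hr : aeval α (genPoly g) = 0) (c : Fin 18 → F4) :
    extQR4Mem α c ↔ ∃ h, encode g h = c := by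
  rw [extQR4Mem, qr4Mem_iff hg h8 hα hr]
  constructor
  · rintro ⟨⟨h, hh⟩, hl⟩
    refine ⟨h, funext fun i => ?_⟩
    have hh' := fun i => congrFun hh i
    cases i using Fin.lastCases with
    | last => rw [encode_last_eq_neg_sum hg h8 hodd, hl]; simp [hh']
    | cast i => exact (hh' i).symm
  · rintro ⟨h, rfl⟩
    exact ⟨⟨h, rfl⟩, encode_last_eq_neg_sum hg h8 hodd h⟩

theorem aeval_genPoly_eq_zero (hα : IsPrimitiveRoot α 17) :
    aeval α (genPoly 313) = 0 ∨ aeval α (genPoly 471) = 0 := by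
  have : CharP K 2 := charP_of_injective_algebraMap (algebraMap F4 K).injective 2
  have h2 : (2 : K) = 0 := CharTwo.two_eq_zero
  have h1 : α - 1 ≠ 0 := sub_ne_zero.2 (hα.ne_one (by norm_num))
  have h17 := hα.pow_eq_one
  have e1 : aeval α (genPoly 313) = 1 + α ^ 3 + α ^ 4 + α ^ 5 + α ^ 8 := by
    simp [aeval_genPoly, Finset.sum_range_succ, Nat.testBit]
  have e2 : aeval α (genPoly 471) = 1 + α + α ^ 2 + α ^ 4 + α ^ 6 + α ^ 7 + α ^ 8 := by
    simp [aeval_genPoly, Finset.sum_range_succ, Nat.testBit]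
  rw [← mul_eq_zero, e1, e2]
  refine (mul_eq_zero.1 ?_).resolve_right h1
  linear_combination h17 + (α ^ 13 - α ^ 4) * h2

theorem ncard_shell_thirteen {g : ℕ} (hg : g < 2 ^ 9) (h8 : g.testBit 8 = true)
    (hodd : (genPoly g).eval 1 = 1) (hd : checkDesign g = true) (hα : IsPrimitiveRoot α 17)
    (hr : aeval α (genPoly g) = 0) {T : Finset (Fin 18)} (hT : T.card = 3) :
    {c : Fin 18 → F4 | extQR4Mem α c ∧ wt c = 13 ∧ T ⊆ supp c}.ncard = 18018 := by
  obtain ⟨ω, h0, h1⟩ := exists_F4_ne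
  have himage : {c : Fin 18 → F4 | extQR4Mem α c ∧ wt c = 13 ∧ T ⊆ supp c} =
      (fun j => encode g (message ω j)) '' ((Finset.range (2 ^ 18)).filter fun j =>
        wt (encode g (message ω j)) = 13 ∧ T ⊆ supp (encode g (message ω j)) : Finset ℕ) := by
    ext c
    simp only [Set.mem_ofPred_eq, extQR4Mem_iff hg h8 hodd hα hr, Set.mem_image,
      Finset.coe_filter, Finset.mem_range]
    constructor
    · rintro ⟨⟨h, rfl⟩, hc⟩
      obtain ⟨j, hj, rfl⟩ := message_surjOn h0 h1 h
      exact ⟨j, ⟨hj, hc⟩, rfl⟩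
    · rintro ⟨j, ⟨-, hc⟩, rfl⟩
      exact ⟨⟨_, rfl⟩, hc⟩
  have hinj : Set.InjOn (fun j => encode g (message ω j))
      ((Finset.range (2 ^ 18)).filter fun j =>
        wt (encode g (message ω j)) = 13 ∧ T ⊆ supp (encode g (message ω j)) : Finset ℕ) :=
    fun j hj j' hj' e => message_injOn h0 h1 (Finset.filter_subset _ _ hj)
      (Finset.filter_subset _ _ hj') (encode_injective hg h8 e)
  rw [himage, hinj.ncard_image, Set.ncard_coe_finset]
  exact card_messages h0 h1 hd hT

theorem eval_one_genPoly_313 : (genPoly 313).eval 1 = 1 := by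
  have h2 : (2 : F4) = 0 := CharTwo.two_eq_zero
  have : (genPoly 313).eval 1 = 1 + 1 + 1 + 1 + 1 := by
    simp [genPoly, Finset.sum_range_succ, Nat.testBit]
  linear_combination this + 2 * h2

theorem eval_one_genPoly_471 : (genPoly 471).eval 1 = 1 := by
  have h2 : (2 : F4) = 0 := CharTwo.two_eq_zero
  have : (genPoly 471).eval 1 = 1 + 1 + 1 + 1 + 1 + 1 + 1 := by
    simp [genPoly, Finset.sum_range_succ, Nat.testBit]
  linear_combination this + 3 * h2

end Cyclic

/-- For the extended quaternary quadratic residue code `C` of length 18, the shell `C₁₃` is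
a combinatorial `3`-`(18, 13, 18018)` design with repeated blocks: every 3-element subset
of the coordinates is contained in the support of exactly 18018 codewords of weight 13. -/
theorem quaternary_shell_thirteen_three_design (K : Type) [Field K] [Algebra F4 K] (α : K)
    (hα : IsPrimitiveRoot α 17) :
    ∀ T : Finset (Fin 18), T.card = 3 →
      {c : Fin 18 → F4 | extQR4Mem α c ∧ wt c = 13 ∧ T ⊆ supp c}.ncard = 18018 := by
  intro T hT
  rcases aeval_genPoly_eq_zero hα with h | h
  · exact ncard_shell_thirteen (by norm_num) (by decide) eval_one_genPoly_313 checkDesign_313 hα h hT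
  · exact ncard_shell_thirteen (by norm_num) (by decide) eval_one_genPoly_471 checkDesign_471 hα h hT
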